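/- arXiv:1602.00724 — 2 statements merged into one kernel-verified Lean document; each statement's English description precedes it below -/
import Mathlib

section
/- Assume the sequence (τ_t)_{t≥0} is nonincreasing and let T ≥ 0 satisfy 1 − (4 n μ̄ d_η / μ_) τ_T > 0. Then for every t ≥ 0, C_t ≤ C, where C := max{ 2 d_Ψ d_𝒞 / μ_, C_0 · Π_{k=0}^{T} (1 − τ_k)^{−1}, 64 n² μ̄² d_η² / ( μ_³ (1 − (4 n μ̄ d_η / μ_) τ_T) ) } is a constant independent of t. -/
noncomputable section

/-- The spectral norm (largest singular value) of a real square matrix. -/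
def specNorm {p : ℕ} (M : Matrix (Fin p) (Fin p) ℝ) : ℝ :=
  ‖(Matrix.toEuclideanCLM (𝕜 := ℝ) M :
      EuclideanSpace ℝ (Fin p) →L[ℝ] EuclideanSpace ℝ (Fin p))‖

open scoped MatrixOrder Matrix.Norms.L2Operator in
theorem Matrix.PosSemidef.exists_eq_conjTranspose_mul_self {p : ℕ} {Y : Matrix (Fin p) (Fin p) ℝ}
    (hY : Y.PosSemidef) : ∃ B : Matrix (Fin p) (Fin p) ℝ, Y = B.conjTranspose * B :=
  CStarAlgebra.nonneg_iff_eq_star_mul_self.mp hY.nonneg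

theorem Matrix.PosSemidef.trace_mul_nonneg_of_posSemidef {p : ℕ} {A Y : Matrix (Fin p) (Fin p) ℝ}
    (hA : A.PosSemidef) (hY : Y.PosSemidef) : 0 ≤ (A * Y).trace := by
  obtain ⟨B, rfl⟩ := hY.exists_eq_conjTranspose_mul_self
  rw [← Matrix.mul_assoc, Matrix.trace_mul_comm, ← Matrix.mul_assoc]
  exact (hA.mul_mul_conjTranspose_same B).trace_nonneg

theorem abs_dotProduct_mulVec_le_specNorm {p : ℕ} (A : Matrix (Fin p) (Fin p) ℝ)
    (x : Fin p → ℝ) : |x ⬝ᵥ A.mulVec x| ≤ specNorm A * (x ⬝ᵥ x) := by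
  set u : EuclideanSpace ℝ (Fin p) := WithLp.toLp 2 x
  set L := Matrix.toEuclideanCLM (𝕜 := ℝ) A
  have h1 : inner ℝ u (L u) = x ⬝ᵥ A.mulVec x := by
    simp [u, L, EuclideanSpace.inner_eq_star_dotProduct, dotProduct_comm]
  have h2 : ‖u‖ * ‖u‖ = x ⬝ᵥ x := by
    rw [← real_inner_self_eq_norm_mul_norm]
    rw [EuclideanSpace.inner_eq_star_dotProduct]
    simp [u]
  calc |x ⬝ᵥ A.mulVec x| = |inner ℝ u (L u)| := by rw [h1]
    _ ≤ ‖u‖ * ‖L u‖ := abs_real_inner_le_norm _ _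
    _ ≤ ‖u‖ * (‖L‖ * ‖u‖) := by gcongr; exact L.le_opNorm u
    _ = specNorm A * (x ⬝ᵥ x) := by rw [← h2]; simp only [specNorm, L]; ring

theorem abs_trace_mul_le_specNorm_mul_trace {p : ℕ} (A : Matrix (Fin p) (Fin p) ℝ)
    {Y : Matrix (Fin p) (Fin p) ℝ} (hY : Y.PosSemidef) :
    |(A * Y).trace| ≤ specNorm A * Y.trace := by
  obtain ⟨B, rfl⟩ := hY.exists_eq_conjTranspose_mul_self
  have h1 : (A * (B.conjTranspose * B)).trace = ∑ k, B k ⬝ᵥ A.mulVec (B k) := by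
    rw [← Matrix.mul_assoc, Matrix.trace_mul_comm, Matrix.trace]
    refine Finset.sum_congr rfl fun k _ => ?_
    simp [Matrix.mul_apply, dotProduct, Matrix.mulVec]
  have h2 : (B.conjTranspose * B).trace = ∑ k, B k ⬝ᵥ B k := by
    rw [Matrix.trace_mul_comm, Matrix.trace]
    refine Finset.sum_congr rfl fun k _ => ?_
    simp [Matrix.mul_apply, dotProduct]
  rw [h1, h2, Finset.mul_sum]
  exact (Finset.abs_sum_le_sum_abs _ _).trans
    (Finset.sum_le_sum fun k _ => abs_dotProduct_mulVec_le_specNorm A (B k))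

theorem div_convexComb_le {η a v τ : ℝ} (hη : 0 ≤ η) (ha : 0 < a) (hv : 0 ≤ v)
    (hτ0 : 0 < τ) (hτ1 : τ < 1) :
    η / ((1 - τ) * a + τ * v) ≤ (1 - τ)⁻¹ * (η / a) := by
  have h : 0 < 1 - τ := by linarith
  rw [← one_div, div_mul_div_comm, one_mul]
  have := mul_nonneg hτ0.le hv
  have := mul_pos h ha
  gcongr
  linarith

theorem sum_div_convexComb_le {n : ℕ} {η a v : Fin n → ℝ} {τ : ℝ} (hη : ∀ i, 0 ≤ η i)
    (ha : ∀ i, 0 < a i) (hv : ∀ i, 0 ≤ v i) (hτ0 : 0 < τ) (hτ1 : τ < 1) :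
    ∑ i, η i / ((1 - τ) * a i + τ * v i) ≤ (1 - τ)⁻¹ * ∑ i, η i / a i := by
  rw [Finset.mul_sum]
  exact Finset.sum_le_sum fun i _ => div_convexComb_le (hη i) (ha i) (hv i) hτ0 hτ1

/-- It suffices that one coordinate decreases enough to compensate the growth of the others. -/
theorem sum_div_convexComb_le_self {n : ℕ} {η a v : Fin n → ℝ} {τ : ℝ} (hη : ∀ i, 0 ≤ η i)
    (ha : ∀ i, 0 < a i) (hv : ∀ i, 0 ≤ v i) (hτ0 : 0 < τ) (hτ1 : τ < 1) (i : Fin n)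
    (h : (∑ j, η j / a j) * ((1 - τ) * a i + τ * v i) ≤ η i / a i * v i) :
    ∑ j, η j / ((1 - τ) * a j + τ * v j) ≤ ∑ j, η j / a j := by
  have h1 : 0 < 1 - τ := by linarith
  set C := ∑ j, η j / a j with hC
  have hsplit : C = η i / a i + ∑ j ∈ Finset.univ.erase i, η j / a j :=
    (Finset.add_sum_erase _ _ (Finset.mem_univ i)).symm
  have hrest : ∑ j ∈ Finset.univ.erase i, η j / ((1 - τ) * a j + τ * v j)
      ≤ (1 - τ)⁻¹ * ∑ j ∈ Finset.univ.erase i, η j / a j := by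
    rw [Finset.mul_sum]
    exact Finset.sum_le_sum fun j _ => div_convexComb_le (hη j) (ha j) (hv j) hτ0 hτ1
  rw [← Finset.add_sum_erase _ _ (Finset.mem_univ i)]
  have hD : 0 < (1 - τ) * a i + τ * v i :=
    add_pos_of_pos_of_nonneg (mul_pos h1 (ha i)) (mul_nonneg hτ0.le (hv i))
  have hai := ha i
  have hkey : (1 - τ) * (η i / ((1 - τ) * a i + τ * v i)) ≤ η i / a i - τ * C := by
    have e : (1 - τ) * (η i / ((1 - τ) * a i + τ * v i))
        = η i / a i - τ * (η i / a i * v i / ((1 - τ) * a i + τ * v i)) := by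
      field_simp
      ring
    have : C ≤ η i / a i * v i / ((1 - τ) * a i + τ * v i) := (le_div_iff₀ hD).2 h
    rw [e]
    gcongr
  have hr : ∑ j ∈ Finset.univ.erase i, η j / a j = C - η i / a i := by linarith
  rw [hr] at hrest
  have hrest' := mul_le_mul_of_nonneg_left hrest h1.le
  rw [mul_inv_cancel_left₀ h1.ne'] at hrest'
  refine le_of_mul_le_mul_left ?_ h1
  rw [mul_add]
  linarith

theorem sum_div_convexComb_le_of_large {n : ℕ} (hn : 1 ≤ n) {η a v : Fin n → ℝ} {τ d μ M : ℝ}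
    (hη : ∀ i, 0 ≤ η i) (hηd : ∀ i, η i ≤ d) (ha : ∀ i, 0 < a i) (hv : ∀ i, 0 ≤ v i)
    (hvM : ∀ i, v i ≤ M) (hτ0 : 0 < τ) (hτ1 : τ < 1) (hd : 1 ≤ d) (hμ : 0 < μ) (hM : 0 < M)
    (hτ : 4 * n * M * τ ≤ μ)
    (hsum : (∑ i, η i / a i) * μ / 3 ≤ ∑ i, η i / a i * v i)
    (hlarge : 36 * n ^ 2 * M * d / μ ^ 2 ≤ ∑ i, η i / a i) :
    ∑ i, η i / ((1 - τ) * a i + τ * v i) ≤ ∑ i, η i / a i := by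
  set C := ∑ i, η i / a i with hC
  have hn' : (1 : ℝ) ≤ n := by exact_mod_cast hn
  have hn0 : (0 : ℝ) < n := by linarith
  have hCpos : 0 < C := lt_of_lt_of_le (by positivity) hlarge
  obtain ⟨i, -, hi⟩ : ∃ i ∈ (Finset.univ : Finset (Fin n)),
      C * μ / (3 * n) ≤ η i / a i * v i := by
    have : Nonempty (Fin n) := ⟨⟨0, hn⟩⟩
    refine Finset.exists_le_of_sum_le Finset.univ_nonempty (le_trans (le_of_eq ?_) hsum)
    simp only [Finset.sum_const, Finset.card_univ, Fintype.card_fin, nsmul_eq_mul]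
    field_simp
  refine sum_div_convexComb_le_self hη ha hv hτ0 hτ1 i ?_
  rw [← hC]
  have hai := ha i
  set w := η i / a i with hw
  have hw0 : 0 ≤ w := div_nonneg (hη i) hai.le
  have hwa : w * a i = η i := div_mul_cancel₀ _ hai.ne'
  have hwM : C * μ ≤ 3 * n * M * w := by
    have := hi.trans (mul_le_mul_of_nonneg_left (hvM i) hw0)
    rw [div_le_iff₀ (by positivity)] at this
    linarith
  have hwv : C * μ ≤ 3 * n * (w * v i) := by
    rw [div_le_iff₀ (by positivity)] at hi
    linarith
  have hτw : C * τ ≤ 3 / 4 * w := by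
    have e1 : (4 * n * M) * (C * τ) ≤ (4 * n * M) * (3 / 4 * w) := by
      have := mul_le_mul_of_nonneg_left hτ hCpos.le
      linarith
    exact le_of_mul_le_mul_left e1 (by positivity)
  have h2 : C * τ * v i ≤ 3 / 4 * (w * v i) := by
    have := mul_le_mul_of_nonneg_right hτw (hv i)
    linarith
  have hCa : C * μ * a i ≤ 3 * n * M * d := by
    have e1 := mul_le_mul_of_nonneg_right hwM hai.le
    have e2 : 3 * n * M * (w * a i) ≤ 3 * n * M * d := by
      rw [hwa]
      exact mul_le_mul_of_nonneg_left (hηd i) (by positivity)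
    linarith
  have hl : 36 * n ^ 2 * M * d ≤ C * μ ^ 2 := by
    rwa [div_le_iff₀ (by positivity)] at hlarge
  have h3 : C * a i ≤ 1 / 4 * (w * v i) := by
    have e1 : (12 * n * μ) * (C * a i) ≤ (12 * n * μ) * (1 / 4 * (w * v i)) := by
      calc (12 * n * μ) * (C * a i) = 12 * n * (C * μ * a i) := by ring
        _ ≤ 12 * n * (3 * n * M * d) := by gcongr
        _ = 36 * n ^ 2 * M * d := by ring
        _ ≤ C * μ ^ 2 := hl
        _ = μ * (C * μ) := by ring
        _ ≤ μ * (3 * n * (w * v i)) := by gcongr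
        _ = _ := by ring
    exact le_of_mul_le_mul_left e1 (by positivity)
  have h4 : 0 ≤ τ * (C * a i) := by positivity
  linarith


/-- Key lemma: `C_t ≤ C` for all `t`, where
`C = max{2 d_Ψ d_𝒞/μ_, C_0 ∏_{k≤T}(1-τ_k)⁻¹, 64 n² μ̄² d_η²/(μ_³(1-(4 n μ̄ d_η/μ_)τ_T))}`. -/
theorem frankWolfe_key_lemma
    (p n : ℕ) (hp : 1 ≤ p) (hn : 1 ≤ n) (c : ℝ) (hc : 0 < c)
    (Ψ : Matrix (Fin p) (Fin p) ℝ) (η : Fin n → ℕ)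
    (Φ : Fin n → Matrix (Fin p) (Fin p) ℝ) (hΦ : ∀ i, (Φ i).PosSemidef)
    (α : ℕ → ℝ) (hα : ∀ t, 0 ≤ α t) (hα0 : 0 < α 0)
    (S : ℕ → ℝ) (hS : ∀ t, S t = ∑ k ∈ Finset.range (t + 1), α k)
    (τ : ℕ → ℝ) (hτ : ∀ t, τ t = α (t + 1) / S (t + 1))
    (hτ01 : ∀ t, 0 < τ t ∧ τ t < 1)
    (G : Matrix (Fin p) (Fin p) ℝ → Matrix (Fin p) (Fin p) ℝ)
    (hG : ∀ Y, G Y = Ψ - ∑ i, ((η i : ℝ) / (((Φ i) * Y).trace)) • Φ i)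
    (X V : ℕ → Matrix (Fin p) (Fin p) ℝ)
    (hX0 : (X 0).PosSemidef ∧ (X 0).trace ≤ c)
    (hX0pos : ∀ i, 0 < ((Φ i) * (X 0)).trace)
    (hV : ∀ t, (V t).PosSemidef ∧ (V t).trace ≤ c)
    (hVmin : ∀ (t : ℕ) (W : Matrix (Fin p) (Fin p) ℝ), W.PosSemidef → W.trace ≤ c →
      ((G (X t)) * (V t)).trace ≤ ((G (X t)) * W).trace)
    (hXsucc : ∀ t, X (t + 1) = (1 - τ t) • X t + τ t • V t)
    (C : ℕ → ℝ) (hC : ∀ t, C t = ∑ i, (η i : ℝ) / (((Φ i) * (X t)).trace))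
    (dC dΦ dΨ dη μbar μlow : ℝ)
    (hdC : dC = 2 * c) (hdΦ : dΦ = ⨆ i, specNorm (Φ i)) (hdΨ : dΨ = specNorm Ψ)
    (hdη : dη = ⨆ i, (η i : ℝ))
    (hμbar : IsGreatest {v : ℝ | ∃ (i : Fin n) (Y : Matrix (Fin p) (Fin p) ℝ),
      Y.PosSemidef ∧ Y.trace ≤ c ∧ v = ((Φ i) * Y).trace} μbar)
    (hμlow : μlow = ⨅ i, ((Φ i) * (X 0)).trace)
    (hτmono : Antitone τ)
    (T : ℕ) (hT : 0 < 1 - (4 * (n : ℝ) * μbar * dη / μlow) * τ T) :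
    ∀ t : ℕ,
      C t ≤ max (2 * dΨ * dC / μlow)
        (max (C 0 * ∏ k ∈ Finset.range (T + 1), (1 - τ k)⁻¹)
          (64 * (n : ℝ) ^ 2 * μbar ^ 2 * dη ^ 2 /
            (μlow ^ 3 * (1 - (4 * (n : ℝ) * μbar * dη / μlow) * τ T)))) := by
  have hn' : (1 : ℝ) ≤ n := by exact_mod_cast hn
  have : Nonempty (Fin n) := ⟨⟨0, hn⟩⟩
  have hη0 : ∀ i, (0 : ℝ) ≤ η i := fun i => Nat.cast_nonneg _
  have hηd : ∀ i, (η i : ℝ) ≤ dη := fun i => by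
    rw [hdη]
    exact le_ciSup (Set.finite_range fun i => (η i : ℝ)).bddAbove i
  have hμle : ∀ i, μlow ≤ ((Φ i) * (X 0)).trace := fun i => by
    rw [hμlow]
    exact ciInf_le (Set.finite_range fun i => ((Φ i) * (X 0)).trace).bddBelow i
  have hμpos : 0 < μlow := by
    obtain ⟨i, hi⟩ := exists_eq_ciInf_of_finite (f := fun i => ((Φ i) * (X 0)).trace)
    rw [hμlow, ← hi]
    exact hX0pos i
  have hμM : μlow ≤ μbar :=
    (hμle ⟨0, hn⟩).trans (hμbar.2 ⟨_, X 0, hX0.1, hX0.2, rfl⟩)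
  have hMpos : 0 < μbar := hμpos.trans_le hμM
  have hv0 : ∀ t i, 0 ≤ ((Φ i) * (V t)).trace := fun t i =>
    (hΦ i).trace_mul_nonneg_of_posSemidef (hV t).1
  have hvM : ∀ t i, ((Φ i) * (V t)).trace ≤ μbar := fun t i =>
    hμbar.2 ⟨i, V t, (hV t).1, (hV t).2, rfl⟩
  have hstep : ∀ t i, ((Φ i) * (X (t + 1))).trace =
      (1 - τ t) * ((Φ i) * (X t)).trace + τ t * ((Φ i) * (V t)).trace := fun t i => by
    rw [hXsucc]
    simp [Matrix.mul_add, Matrix.trace_add]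
  have ha : ∀ t i, 0 < ((Φ i) * (X t)).trace := by
    intro t
    induction t with
    | zero => exact hX0pos
    | succ t ih =>
      intro i
      rw [hstep]
      exact add_pos_of_pos_of_nonneg (mul_pos (by linarith [(hτ01 t).2]) (ih i))
        (mul_nonneg (hτ01 t).1.le (hv0 t i))
  have hC0 : ∀ t, 0 ≤ C t := fun t => by
    rw [hC]
    exact Finset.sum_nonneg fun i _ => div_nonneg (hη0 i) (ha t i).le
  have hgrow : ∀ t, C (t + 1) ≤ (1 - τ t)⁻¹ * C t := fun t => by
    rw [hC, hC]
    simp only [hstep]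
    exact sum_div_convexComb_le hη0 (ha t) (hv0 t) (hτ01 t).1 (hτ01 t).2
  have hinv : ∀ t, 1 ≤ (1 - τ t)⁻¹ := fun t =>
    (one_le_inv₀ (by linarith [(hτ01 t).2])).2 (by linarith [(hτ01 t).1])
  have hprod : ∀ t, C t ≤ C 0 * ∏ k ∈ Finset.range t, (1 - τ k)⁻¹ := by
    intro t
    induction t with
    | zero => simp
    | succ t ih =>
      rw [Finset.prod_range_succ]
      calc C (t + 1) ≤ (1 - τ t)⁻¹ * C t := hgrow t
        _ ≤ (1 - τ t)⁻¹ * (C 0 * ∏ k ∈ Finset.range t, (1 - τ k)⁻¹) :=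
          mul_le_mul_of_nonneg_left ih (by linarith [hinv t])
        _ = _ := by ring
  have hdΨ0 : 0 ≤ dΨ := by rw [hdΨ]; exact norm_nonneg _
  have htr : ∀ Y : Matrix (Fin p) (Fin p) ℝ, Y.PosSemidef → Y.trace ≤ c →
      |(Ψ * Y).trace| ≤ dΨ * c := fun Y hY hYc => by
    rw [hdΨ] at hdΨ0 ⊢
    exact (abs_trace_mul_le_specNorm_mul_trace Ψ hY).trans
      (mul_le_mul_of_nonneg_left hYc hdΨ0)
  have hGtr : ∀ t Y, ((G (X t)) * Y).trace = (Ψ * Y).trace -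
      ∑ i, (η i : ℝ) / ((Φ i) * (X t)).trace * ((Φ i) * Y).trace := fun t Y => by
    rw [hG, Matrix.sub_mul, Matrix.trace_sub, Finset.sum_mul, Matrix.trace_sum]
    simp
  have hlmo : ∀ t, C t * μlow - dΨ * dC ≤
      ∑ i, (η i : ℝ) / ((Φ i) * (X t)).trace * ((Φ i) * (V t)).trace := fun t => by
    have h1 := hVmin t (X 0) hX0.1 hX0.2
    rw [hGtr, hGtr] at h1
    have h2 : C t * μlow ≤
        ∑ i, (η i : ℝ) / ((Φ i) * (X t)).trace * ((Φ i) * (X 0)).trace := by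
      rw [hC, Finset.sum_mul]
      exact Finset.sum_le_sum fun i _ =>
        mul_le_mul_of_nonneg_left (hμle i) (div_nonneg (hη0 i) (ha t i).le)
    have h3 := abs_le.1 (htr _ hX0.1 hX0.2)
    have h4 := abs_le.1 (htr _ (hV t).1 (hV t).2)
    rw [hdC]
    linarith [h3.2, h4.1]
  set R₁ := 2 * dΨ * dC / μlow with hR₁
  set θ := 4 * (n : ℝ) * μbar * dη / μlow * τ T with hθ
  set R₃ := 64 * (n : ℝ) ^ 2 * μbar ^ 2 * dη ^ 2 / (μlow ^ 3 * (1 - θ)) with hR₃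
  set R := max R₁ (max (C 0 * ∏ k ∈ Finset.range (T + 1), (1 - τ k)⁻¹) R₃) with hR
  have hR₁0 : 0 ≤ R₁ := by
    rw [hR₁, hdC]
    positivity
  by_cases hzero : ∀ i, η i = 0
  · intro t
    rw [hC]
    simp only [hzero, Nat.cast_zero, zero_div, Finset.sum_const_zero]
    exact hR₁0.trans (le_max_left _ _)
  push Not at hzero
  obtain ⟨i₀, hi₀⟩ := hzero
  have hd1 : 1 ≤ dη := le_trans (by exact_mod_cast Nat.one_le_iff_ne_zero.2 hi₀) (hηd i₀)
  have hτT : ∀ t, T ≤ t → 4 * n * μbar * τ t ≤ μlow := fun t ht => by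
    have h1 : 4 * (n : ℝ) * μbar * dη * τ T ≤ μlow := by
      have : θ = 4 * (n : ℝ) * μbar * dη * τ T / μlow := by rw [hθ]; ring
      rw [this, sub_pos, div_lt_one hμpos] at hT
      exact hT.le
    have h0 := (hτ01 T).1
    calc 4 * n * μbar * τ t ≤ 4 * n * μbar * τ T := by
          gcongr
          exact hτmono ht
      _ = 4 * n * μbar * 1 * τ T := by ring
      _ ≤ 4 * n * μbar * dη * τ T := by gcongr
      _ ≤ μlow := h1
  have hR₃' : 64 * n ^ 2 * μbar * dη / μlow ^ 2 ≤ R₃ := by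
    have hθ0 : 0 ≤ θ := by
      have := (hτ01 T).1
      positivity
    calc 64 * n ^ 2 * μbar * dη / μlow ^ 2
        = 64 * n ^ 2 * μbar * dη * (μlow * 1) / (μlow ^ 3 * 1) := by field_simp
      _ ≤ 64 * n ^ 2 * μbar * dη * (μbar * dη) / (μlow ^ 3 * (1 - θ)) := by
        gcongr
        linarith
      _ = R₃ := by rw [hR₃]; ring
  have hmain : ∀ t, T ≤ t → C t ≤ R → C (t + 1) ≤ R := fun t ht hCR => by
    have hτt := hτT t ht
    obtain ⟨hτ0, hτ1⟩ := hτ01 t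
    have hτ4 : τ t ≤ 1 / 4 := by
      have : 4 * μlow * τ t ≤ μlow * 1 :=
        calc 4 * μlow * τ t = 4 * 1 * μlow * τ t := by ring
          _ ≤ 4 * n * μbar * τ t := by gcongr
          _ ≤ μlow * 1 := by linarith
      have : μlow * (4 * τ t) ≤ μlow * 1 := by linarith
      linarith [le_of_mul_le_mul_left this hμpos]
    have h1 : 0 < 1 - τ t := by linarith
    rcases le_total (C t) ((1 - τ t) * R) with hle | hle
    · calc C (t + 1) ≤ (1 - τ t)⁻¹ * C t := hgrow t
        _ ≤ (1 - τ t)⁻¹ * ((1 - τ t) * R) := by gcongr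
        _ = R := inv_mul_cancel_left₀ h1.ne' R
    · have hRR₁ : R₁ ≤ R := le_max_left _ _
      have hRR₃ : R₃ ≤ R := (le_max_right _ _).trans (le_max_right _ _)
      have hR34 : 3 / 4 * R ≤ C t := by
        have : 3 / 4 * R ≤ (1 - τ t) * R :=
          mul_le_mul_of_nonneg_right (by linarith) (hR₁0.trans hRR₁)
        linarith
      refine le_trans ?_ hCR
      have hl := hlmo t
      have hR₁μ : R₁ * μlow = 2 * (dΨ * dC) := by rw [hR₁]; field_simp
      have hsum : C t * μlow / 3 ≤
          ∑ i, (η i : ℝ) / ((Φ i) * (X t)).trace * ((Φ i) * (V t)).trace := by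
        have : 3 / 4 * R₁ * μlow ≤ C t * μlow :=
          mul_le_mul_of_nonneg_right (by linarith) hμpos.le
        linarith
      have hlarge : 36 * n ^ 2 * μbar * dη / μlow ^ 2 ≤ C t := by
        have e : 36 * n ^ 2 * μbar * dη / μlow ^ 2
            = 36 / 64 * (64 * n ^ 2 * μbar * dη / μlow ^ 2) := by ring
        have : 0 ≤ 64 * n ^ 2 * μbar * dη / μlow ^ 2 := by positivity
        linarith
      rw [hC] at hsum hlarge
      rw [hC, hC]
      simp only [hstep]
      exact sum_div_convexComb_le_of_large hn hη0 hηd (ha t) (hv0 t) (hvM t) hτ0 hτ1 hd1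
        hμpos hMpos hτt hsum hlarge
  have hearly : ∀ t, t ≤ T → C t ≤ R := fun t ht => by
    refine (hprod t).trans (le_trans ?_ ((le_max_left _ _).trans (le_max_right _ _)))
    refine mul_le_mul_of_nonneg_left ?_ (hC0 0)
    exact Finset.prod_le_prod_of_subset_of_one_le
      (Finset.range_mono (by omega)) (fun k _ => by linarith [hinv k]) (fun k _ _ => hinv k)
  intro t
  rcases le_total t T with ht | ht
  · exact hearly t ht
  · induction t, ht using Nat.le_induction with
    | base => exact hearly T le_rfl
    | succ t ht ih => exact hmain t ht ih
end
end

section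
/- For every t ≥ 0 and every X ∈ 𝒞 with Tr(Φ_i X) > 0 for all i = 1, …, n, one has g(X_t) − g(X) ≤ B_t / S_t. -/
noncomputable section

open scoped MatrixOrder Matrix.Norms.L2Operator in
/-- The trace of a product of two positive semidefinite matrices is nonnegative. -/
theorem Matrix.PosSemidef.trace_mul_nonneg {m : Type*} [Fintype m] [DecidableEq m]
    {A B : Matrix m m ℝ} (hA : A.PosSemidef) (hB : B.PosSemidef) : 0 ≤ (A * B).trace := by
  obtain ⟨D, rfl⟩ := CStarAlgebra.nonneg_iff_eq_star_mul_self.mp hB.nonneg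
  rw [← Matrix.mul_assoc, Matrix.trace_mul_comm, ← Matrix.mul_assoc]
  exact (hA.mul_mul_conjTranspose_same D).trace_nonneg

theorem specNorm_nonneg {p : ℕ} (M : Matrix (Fin p) (Fin p) ℝ) : 0 ≤ specNorm M :=
  norm_nonneg _

/-- A symmetric matrix is dominated by its spectral norm times the identity. -/
theorem posSemidef_specNorm_smul_one_sub {p : ℕ} {A : Matrix (Fin p) (Fin p) ℝ}
    (hA : A.IsHermitian) : (specNorm A • (1 : Matrix (Fin p) (Fin p) ℝ) - A).PosSemidef := by
  refine .of_dotProduct_mulVec_nonneg ?_ fun x ↦ ?_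
  · refine Matrix.IsHermitian.sub ?_ hA
    simp [Matrix.IsHermitian]
  · have h := real_inner_le_norm (WithLp.toLp 2 x)
      (Matrix.toEuclideanCLM (𝕜 := ℝ) A (WithLp.toLp 2 x))
    rw [Matrix.inner_toEuclideanCLM] at h
    have h' := (Matrix.toEuclideanCLM (𝕜 := ℝ) A).le_opNorm (WithLp.toLp 2 x)
    have hx : x ⬝ᵥ x = ‖WithLp.toLp 2 x‖ ^ 2 := by
      rw [← real_inner_self_eq_norm_sq, EuclideanSpace.inner_toLp_toLp, star_trivial]
    simp only [star_trivial, Matrix.sub_mulVec, Matrix.smul_mulVec, Matrix.one_mulVec,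
      dotProduct_sub, dotProduct_smul, smul_eq_mul, hx]
    have := mul_le_mul_of_nonneg_left h' (norm_nonneg (WithLp.toLp 2 x))
    unfold specNorm
    nlinarith

theorem trace_mul_le_specNorm_mul_trace {p : ℕ} {A B : Matrix (Fin p) (Fin p) ℝ}
    (hA : A.IsHermitian) (hB : B.PosSemidef) : (A * B).trace ≤ specNorm A * B.trace := by
  have h := (posSemidef_specNorm_smul_one_sub hA).trace_mul_nonneg hB
  rw [Matrix.sub_mul, Matrix.trace_sub, Matrix.smul_mul, Matrix.one_mul, Matrix.trace_smul,
    smul_eq_mul] at h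
  linarith

/-- A function of the form `ψ - ∑ i, η i * log (a i)` lies above its linearization. -/
theorem sum_mul_log_sub_le {ι : Type*} [Fintype ι] (η : ι → ℕ) {a b : ι → ℝ}
    (ha : ∀ i, 0 < a i) (hb : ∀ i, 0 < b i) :
    ∑ i, (η i : ℝ) * Real.log (b i) - ∑ i, (η i : ℝ) * Real.log (a i) ≤
      ∑ i, (η i : ℝ) / a i * (b i - a i) := by
  rw [← Finset.sum_sub_distrib]
  refine Finset.sum_le_sum fun i _ ↦ ?_
  have h := Real.log_le_sub_one_of_pos (div_pos (hb i) (ha i))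
  rw [Real.log_div (hb i).ne' (ha i).ne'] at h
  have h2 := mul_le_mul_of_nonneg_left h (Nat.cast_nonneg (α := ℝ) (η i))
  have ha' := (ha i).ne'
  calc _ = (η i : ℝ) * (Real.log (b i) - Real.log (a i)) := by ring
    _ ≤ _ := h2
    _ = _ := by field_simp

/-- Quadratic lower bound for the logarithm along a segment. -/
theorem mul_sub_div_le_log_add {a v τ D : ℝ} (ha : 0 < a) (hv : 0 ≤ v) (hτ0 : 0 < τ)
    (hτ1 : τ < 1) (hD : (v - a) ^ 2 ≤ D) :
    τ * ((v - a) / a) - τ ^ 2 / (1 - τ) * (D / a ^ 2) ≤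
      Real.log ((1 - τ) * a + τ * v) - Real.log a := by
  have hs : 0 < 1 - τ := sub_pos.mpr hτ1
  have hm : 0 < (1 - τ) * a + τ * v := by positivity
  have h := Real.one_sub_inv_le_log_of_pos (div_pos hm ha)
  rw [Real.log_div hm.ne' ha.ne'] at h
  refine le_trans ?_ h
  have key : τ * ((v - a) / a) - (1 - (((1 - τ) * a + τ * v) / a)⁻¹) =
      τ ^ 2 * (v - a) ^ 2 / (a * ((1 - τ) * a + τ * v)) := by
    field_simp
    ring
  have h2 : τ ^ 2 * (v - a) ^ 2 / (a * ((1 - τ) * a + τ * v)) ≤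
      τ ^ 2 * D / (a * ((1 - τ) * a)) := by
    have hD0 := (sq_nonneg (v - a)).trans hD
    gcongr
    exact le_add_of_nonneg_right (mul_nonneg hτ0.le hv)
  have h3 : τ ^ 2 * D / (a * ((1 - τ) * a)) = τ ^ 2 / (1 - τ) * (D / a ^ 2) := by
    field_simp
  linarith

theorem sum_natCast_div_sq_le_sq_sum {ι : Type*} [Fintype ι] (η : ι → ℕ) {a : ι → ℝ}
    (ha : ∀ i, 0 < a i) : ∑ i, (η i : ℝ) / a i ^ 2 ≤ (∑ i, (η i : ℝ) / a i) ^ 2 := by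
  refine le_trans ?_ (Finset.sum_sq_le_sq_sum_of_nonneg fun i _ ↦
    div_nonneg (Nat.cast_nonneg (η i)) (ha i).le)
  refine Finset.sum_le_sum fun i _ ↦ ?_
  rw [div_pow]
  gcongr
  exact_mod_cast Nat.le_self_pow two_ne_zero (η i)

/-- Decrease of the weighted logarithmic sum along a segment, up to a quadratic error. -/
theorem sum_mul_log_step {ι : Type*} [Fintype ι] (η : ι → ℕ) {a v : ι → ℝ} {τ D K : ℝ}
    (ha : ∀ i, 0 < a i) (hv : ∀ i, 0 ≤ v i) (hτ0 : 0 < τ) (hτ1 : τ < 1) (hD0 : 0 ≤ D)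
    (hD : ∀ i, (v i - a i) ^ 2 ≤ D) (hK : ∑ i, (η i : ℝ) / a i ≤ K) :
    τ * ∑ i, (η i : ℝ) / a i * (v i - a i) - τ ^ 2 / (1 - τ) * (K ^ 2 * D) ≤
      ∑ i, (η i : ℝ) * Real.log ((1 - τ) * a i + τ * v i) -
        ∑ i, (η i : ℝ) * Real.log (a i) := by
  have hs : 0 < 1 - τ := sub_pos.mpr hτ1
  have hsum : 0 ≤ ∑ i, (η i : ℝ) / a i :=
    Finset.sum_nonneg fun i _ ↦ div_nonneg (Nat.cast_nonneg _) (ha i).le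
  have hsq : ∑ i, (η i : ℝ) / a i ^ 2 ≤ K ^ 2 :=
    (sum_natCast_div_sq_le_sq_sum η ha).trans (pow_le_pow_left₀ hsum hK 2)
  calc _ ≤ τ * ∑ i, (η i : ℝ) / a i * (v i - a i) -
        τ ^ 2 / (1 - τ) * ((∑ i, (η i : ℝ) / a i ^ 2) * D) := by gcongr
    _ = ∑ i, (η i : ℝ) * (τ * ((v i - a i) / a i) - τ ^ 2 / (1 - τ) * (D / a i ^ 2)) := by
        rw [Finset.sum_mul, Finset.mul_sum, Finset.mul_sum, ← Finset.sum_sub_distrib]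
        exact Finset.sum_congr rfl fun i _ ↦ by ring
    _ ≤ ∑ i, (η i : ℝ) * (Real.log ((1 - τ) * a i + τ * v i) - Real.log (a i)) :=
        Finset.sum_le_sum fun i _ ↦ mul_le_mul_of_nonneg_left
          (mul_sub_div_le_log_add (ha i) (hv i) hτ0 hτ1 (hD i)) (Nat.cast_nonneg _)
    _ = _ := by simp only [mul_sub, Finset.sum_sub_distrib]

/-- Corollary of the estimate-sequence bound: for every `t` and every feasible `X ∈ 𝒞`
with `Tr(Φ_i X) > 0` for all `i`, one has `g(X_t) - g(X) ≤ B_t / S_t`. -/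
theorem frankWolfe_gap_bound
    (p n : ℕ) (hp : 1 ≤ p) (hn : 1 ≤ n) (c : ℝ) (hc : 0 < c)
    (Ψ : Matrix (Fin p) (Fin p) ℝ) (η : Fin n → ℕ)
    (Φ : Fin n → Matrix (Fin p) (Fin p) ℝ) (hΦ : ∀ i, (Φ i).PosSemidef)
    (α : ℕ → ℝ) (hα : ∀ t, 0 ≤ α t) (hα0 : 0 < α 0)
    (S : ℕ → ℝ) (hS : ∀ t, S t = ∑ k ∈ Finset.range (t + 1), α k)
    (τ : ℕ → ℝ) (hτ : ∀ t, τ t = α (t + 1) / S (t + 1))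
    (hτ01 : ∀ t, 0 < τ t ∧ τ t < 1)
    (G : Matrix (Fin p) (Fin p) ℝ → Matrix (Fin p) (Fin p) ℝ)
    (hG : ∀ Y, G Y = Ψ - ∑ i, ((η i : ℝ) / (((Φ i) * Y).trace)) • Φ i)
    (X V : ℕ → Matrix (Fin p) (Fin p) ℝ)
    (hX0 : (X 0).PosSemidef ∧ (X 0).trace ≤ c)
    (hX0pos : ∀ i, 0 < ((Φ i) * (X 0)).trace)
    (hV : ∀ t, (V t).PosSemidef ∧ (V t).trace ≤ c)
    (hVmin : ∀ (t : ℕ) (W : Matrix (Fin p) (Fin p) ℝ), W.PosSemidef → W.trace ≤ c →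
      ((G (X t)) * (V t)).trace ≤ ((G (X t)) * W).trace)
    (hXsucc : ∀ t, X (t + 1) = (1 - τ t) • X t + τ t • V t)
    (C : ℕ → ℝ) (hC : ∀ t, C t = ∑ i, (η i : ℝ) / (((Φ i) * (X t)).trace))
    (g : Matrix (Fin p) (Fin p) ℝ → ℝ)
    (hg : ∀ Y, g Y = (Ψ * Y).trace - ∑ i, (η i : ℝ) * Real.log (((Φ i) * Y).trace))
    (dC dΦ : ℝ) (hdC : dC = 2 * c) (hdΦ : dΦ = ⨆ i, specNorm (Φ i))
    (Cbar : ℝ) (hCbar : ∀ t : ℕ, C t ≤ Cbar)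
    (γ : ℝ) (hγ : γ = Cbar ^ 2 * dΦ ^ 2 * dC ^ 2)
    (mx : ℝ) (hmx : IsGreatest {v : ℝ | ∃ Y : Matrix (Fin p) (Fin p) ℝ,
      Y.PosSemidef ∧ Y.trace ≤ c ∧ v = ((G (X 0)) * (X 0 - Y)).trace} mx)
    (B : ℕ → ℝ)
    (hB : ∀ t : ℕ, B t = α 0 * mx + (∑ k ∈ Finset.Icc 1 t, (α k) ^ 2 / S (k - 1)) * γ)
    :
    ∀ (t : ℕ) (Y : Matrix (Fin p) (Fin p) ℝ), Y.PosSemidef → Y.trace ≤ c →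
      (∀ i, 0 < ((Φ i) * Y).trace) →
      g (X t) - g Y ≤ B t / S t := by
  intro t Y hY hYc hYpos
  have hX : ∀ t, (X t).PosSemidef ∧ (X t).trace ≤ c ∧ ∀ i, 0 < (Φ i * X t).trace := by
    intro t
    induction t with
    | zero => exact ⟨hX0.1, hX0.2, hX0pos⟩
    | succ t ih =>
      obtain ⟨h1, h2, h3⟩ := ih
      have hs := sub_pos.mpr (hτ01 t).2
      have hτ0 := (hτ01 t).1
      rw [hXsucc]
      refine ⟨(h1.smul hs.le).add ((hV t).1.smul hτ0.le), ?_, fun i ↦ ?_⟩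
      · simp only [Matrix.trace_add, Matrix.trace_smul, smul_eq_mul]
        nlinarith [(hV t).2]
      · simp only [Matrix.mul_add, Matrix.mul_smul, Matrix.trace_add, Matrix.trace_smul,
          smul_eq_mul]
        have := (hΦ i).trace_mul_nonneg (hV t).1
        have := h3 i
        positivity
  have hGZ : ∀ A Z W, (G A * (Z - W)).trace = (Ψ * Z).trace - (Ψ * W).trace -
      ∑ i, (η i : ℝ) / (Φ i * A).trace * ((Φ i * Z).trace - (Φ i * W).trace) := by
    intro A Z W
    simp only [hG, Matrix.sub_mul, Matrix.trace_sub, Finset.sum_mul,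
      Matrix.trace_sum, Matrix.smul_mul, Matrix.trace_smul, smul_eq_mul, mul_sub,
      Finset.sum_sub_distrib]
    ring
  have hconv : ∀ t, g (X t) - g Y ≤ (G (X t) * (X t - Y)).trace := by
    intro t
    have h := sum_mul_log_sub_le η (hX t).2.2 hYpos
    rw [← neg_sub Y, Matrix.mul_neg, Matrix.trace_neg, hGZ, hg, hg]
    linarith
  have hdist : ∀ t i, ((Φ i * V t).trace - (Φ i * X t).trace) ^ 2 ≤ dΦ ^ 2 * dC ^ 2 := by
    intro t i
    have hle : specNorm (Φ i) ≤ dΦ := by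
      rw [hdΦ]
      exact le_ciSup (Set.finite_range fun i ↦ specNorm (Φ i)).bddAbove i
    have hbound : ∀ Z : Matrix (Fin p) (Fin p) ℝ, Z.PosSemidef → Z.trace ≤ c →
        0 ≤ (Φ i * Z).trace ∧ (Φ i * Z).trace ≤ dΦ * dC := by
      intro Z hZ hZc
      refine ⟨(hΦ i).trace_mul_nonneg hZ,
        (trace_mul_le_specNorm_mul_trace (hΦ i).isHermitian hZ).trans ?_⟩
      exact mul_le_mul hle (by linarith) hZ.trace_nonneg ((specNorm_nonneg _).trans hle)
    rw [← mul_pow]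
    obtain ⟨h1, h2⟩ := hbound _ (hV t).1 (hV t).2
    obtain ⟨h3, h4⟩ := hbound _ (hX t).1 (hX t).2.1
    exact sq_le_sq' (by linarith) (by linarith)
  have hstep : ∀ t, g (X (t + 1)) - g Y ≤
      (1 - τ t) * (g (X t) - g Y) + τ t ^ 2 / (1 - τ t) * γ := by
    intro t
    have h := sum_mul_log_step η (hX t).2.2 (fun i ↦ (hΦ i).trace_mul_nonneg (hV t).1)
      (hτ01 t).1 (hτ01 t).2 (by positivity) (hdist t) (hC t ▸ hCbar t)
    have hmin := hVmin t Y hY hYc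
    have hgap := hconv t
    have hlin := hGZ (X t) (V t) (X t)
    rw [Matrix.mul_sub, Matrix.trace_sub] at hgap hlin
    have hdesc : (G (X t) * V t).trace - (G (X t) * X t).trace ≤ -(g (X t) - g Y) := by
      linarith
    rw [hlin] at hdesc
    have hdesc' := mul_le_mul_of_nonneg_left hdesc (hτ01 t).1.le
    have hexp : g (X (t + 1)) = (1 - τ t) * (Ψ * X t).trace + τ t * (Ψ * V t).trace -
        ∑ i, (η i : ℝ) *
          Real.log ((1 - τ t) * (Φ i * X t).trace + τ t * (Φ i * V t).trace) := by
      simp only [hg, hXsucc, Matrix.mul_add, Matrix.mul_smul, Matrix.trace_add,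
        Matrix.trace_smul, smul_eq_mul]
    have hgX := hg (X t)
    have hγ' : γ = Cbar ^ 2 * (dΦ ^ 2 * dC ^ 2) := by rw [hγ]; ring
    rw [← hγ'] at h
    linarith
  have hSsucc : ∀ t, S (t + 1) = S t + α (t + 1) := fun t ↦ by
    rw [hS, hS, Finset.sum_range_succ]
  have hSpos : ∀ t, 0 < S t := by
    intro t
    induction t with
    | zero => simpa [hS] using hα0
    | succ t ih => rw [hSsucc]; linarith [hα (t + 1)]
  rw [le_div_iff₀ (hSpos t)]
  induction t with
  | zero =>
    have h := (hconv 0).trans (hmx.2 ⟨Y, hY, hYc, rfl⟩)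
    have hS0 : S 0 = α 0 := by simp [hS]
    have hB0 : B 0 = α 0 * mx := by simp [hB]
    rw [hS0, hB0, mul_comm]
    exact mul_le_mul_of_nonneg_left h hα0.le
  | succ t ih =>
    have hBsucc : B (t + 1) = B t + α (t + 1) ^ 2 / S t * γ := by
      rw [hB, hB, Finset.sum_Icc_succ_top (by lia), Nat.add_sub_cancel]
      ring
    have h := mul_le_mul_of_nonneg_right (hstep t) (hSpos (t + 1)).le
    have hSt := (hSpos t).ne'
    have hSt' := (hSpos (t + 1)).ne'
    have hτ' : 1 - τ t = S t / S (t + 1) := by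
      rw [hτ, eq_div_iff hSt', sub_mul, div_mul_cancel₀ _ hSt', hSsucc]
      ring
    have hrhs : ((1 - τ t) * (g (X t) - g Y) + τ t ^ 2 / (1 - τ t) * γ) * S (t + 1) =
        (g (X t) - g Y) * S t + α (t + 1) ^ 2 / S t * γ := by
      rw [hτ', hτ]
      field_simp
    linarith
end
end
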